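/- The P_5-chromatic number of the Cartesian product C_4 □ C_4 equals 4: s_5(C_4 □ C_4) = 4. -/

import Mathlib

open SimpleGraph

/-- `f` is a `P_k`-coloring of `G`: a proper vertex coloring such that no path on `k`
vertices is bicolored, i.e. every path on `k` vertices receives at least 3 distinct colors. -/
def IsPkColoring {V α : Type*} [DecidableEq α] (G : SimpleGraph V) (k : ℕ) (f : V → α) : Prop :=
  (∀ u w : V, G.Adj u w → f u ≠ f w) ∧
  ∀ (u w : V) (p : G.Walk u w), p.IsPath → p.length + 1 = k →
    3 ≤ (p.support.map f).toFinset.card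

/-- The `P_k`-chromatic number: the least number of colors of a `P_k`-coloring. -/
noncomputable def pkChrom {V : Type*} (G : SimpleGraph V) (k : ℕ) : ℕ :=
  sInf {n : ℕ | ∃ f : V → Fin n, IsPkColoring G k f}

/-- In a `P₅`-coloring no path on five vertices alternates between two colors. -/
theorem IsPkColoring.not_alternating {V α : Type*} [DecidableEq α] {G : SimpleGraph V}
    {f : V → α} (hf : IsPkColoring G 5 f) {a b c d e : V} (hab : G.Adj a b) (hbc : G.Adj b c)
    (hcd : G.Adj c d) (hde : G.Adj d e) (h : [a, b, c, d, e].Nodup) :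
    ¬ (f a = f c ∧ f c = f e ∧ f b = f d) := by
  rintro ⟨h₁, h₂, h₃⟩
  have key := hf.2 a e (.cons hab (.cons hbc (.cons hcd (.cons hde .nil))))
    (by rw [Walk.isPath_def]; simpa using h) rfl
  have hsub : ([a, b, c, d, e].map f).toFinset ⊆ {f c, f d} := by
    intro x
    simp only [List.map, List.mem_toFinset, List.mem_cons, List.not_mem_nil,
      Finset.mem_insert, Finset.mem_singleton, h₁, ← h₂, h₃]
    tauto
  have := (Finset.card_le_card hsub).trans Finset.card_le_two
  simp only [Walk.support_cons, Walk.support_nil] at key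
  omega

/-- A proper coloring in which no path on five vertices alternates between two colors
is a `P₅`-coloring. -/
theorem isPkColoring_five_of_not_alternating {V α : Type*} [DecidableEq α] {G : SimpleGraph V}
    {f : V → α} (hf : ∀ u w, G.Adj u w → f u ≠ f w)
    (h : ∀ a b c d e, G.Adj a b → G.Adj b c → G.Adj c d → G.Adj d e → [a, b, c, d, e].Nodup →
      ¬ (f a = f c ∧ f c = f e ∧ f b = f d)) : IsPkColoring G 5 f := by
  refine ⟨hf, fun u w p hp hl => ?_⟩
  match p, hp, hl with
  | .cons (v := b) hab (.cons (v := c) hbc (.cons (v := d) hcd (.cons hde .nil))), hp, _ =>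
    rw [Walk.isPath_def] at hp
    have key := h _ _ _ _ _ hab hbc hcd hde (by simpa using hp)
    have n₁ := hf _ _ hab
    have n₂ := hf _ _ hbc
    have n₃ := hf _ _ hcd
    have n₄ := hf _ _ hde
    simp only [Walk.support_cons, Walk.support_nil, List.map]
    obtain ⟨x, y, z, hx, hy, hz, hxy, hxz, hyz⟩ : ∃ x y z, x ∈ [f u, f b, f c, f d, f w] ∧
        y ∈ [f u, f b, f c, f d, f w] ∧ z ∈ [f u, f b, f c, f d, f w] ∧
        x ≠ y ∧ x ≠ z ∧ y ≠ z := by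
      by_cases h₁ : f u = f c
      · by_cases h₃ : f b = f d
        · exact ⟨f c, f d, f w, by simp, by simp, by simp, n₃, fun h₂ => key ⟨h₁, h₂, h₃⟩, n₄⟩
        · exact ⟨f b, f c, f d, by simp, by simp, by simp, n₂, h₃, n₃⟩
      · exact ⟨f u, f b, f c, by simp, by simp, by simp, n₁, h₁, n₂⟩
    exact (Finset.card_eq_three.2 ⟨x, y, z, hxy, hxz, hyz, rfl⟩).symm.le.trans <|
      Finset.card_le_card (s := {x, y, z}) fun t ht => by
        simp only [Finset.mem_insert, Finset.mem_singleton] at ht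
        rw [List.mem_toFinset]
        rcases ht with rfl | rfl | rfl <;> assumption

/-- The coloring `(x, y) ↦ 2 x + y` modulo four is a `P₅`-coloring of `C₄ □ C₄`. -/
theorem isPkColoring_C4_boxProd_C4 : IsPkColoring ((cycleGraph 4).boxProd (cycleGraph 4)) 5
    (fun v : Fin 4 × Fin 4 => 2 * v.1 + v.2) := by
  have step : ∀ x y x' y' x'' y'' : Fin 4,
      ((cycleGraph 4).boxProd (cycleGraph 4)).Adj (x, y) (x', y') →
      ((cycleGraph 4).boxProd (cycleGraph 4)).Adj (x', y') (x'', y'') →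
      (x, y) ≠ (x'', y'') → 2 * x + y = 2 * x'' + y'' → y' = y ∧ y'' = y := by
    simp only [boxProd_adj]
    decide +revert
  refine isPkColoring_five_of_not_alternating ?_ ?_
  · simp only [boxProd_adj]
    decide
  · rintro ⟨a, a'⟩ ⟨b, b'⟩ ⟨c, c'⟩ ⟨d, d'⟩ ⟨e, e'⟩ hab hbc hcd hde h ⟨h₁, h₂, -⟩
    obtain ⟨rfl, rfl⟩ := step _ _ _ _ _ _ hab hbc (by rintro ⟨⟩; simp at h) h₁
    obtain ⟨rfl, rfl⟩ := step _ _ _ _ _ _ hcd hde (by rintro ⟨⟩; simp at h) h₂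
    have : [a, b, c, d, e].Nodup := by simpa using h
    simpa using this.length_le_card

set_option synthInstance.maxSize 4000 in
/-- Already the subgraph induced on seven vertices of `C₄ □ K₂` has no `P₅`-coloring with three
colors. -/
theorem not_isPkColoring_C4_boxProd_C4 (f : Fin 4 × Fin 4 → Fin 3) :
    ¬ IsPkColoring ((cycleGraph 4).boxProd (cycleGraph 4)) 5 f := by
  intro hf
  have adj : ∀ u w : Fin 4 × Fin 4, (u.1 - w.1 = 1 ∨ w.1 - u.1 = 1) ∧ u.2 = w.2 ∨
      (u.2 - w.2 = 1 ∨ w.2 - u.2 = 1) ∧ u.1 = w.1 →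
      ((cycleGraph 4).boxProd (cycleGraph 4)).Adj u w := by
    intro u w h
    simpa only [boxProd_adj, cycleGraph_adj] using h
  have edge (u w) (h) := hf.1 u w (adj u w h)
  have path (a b c d e) (h₁ h₂ h₃ h₄) (h) := hf.not_alternating
    (adj a b h₁) (adj b c h₂) (adj c d h₃) (adj d e h₄) h
  have e1 := edge (0, 0) (0, 1) (by decide)
  have e2 := edge (0, 1) (1, 1) (by decide)
  have e3 := edge (0, 0) (1, 0) (by decide)
  have e4 := edge (1, 1) (1, 0) (by decide)
  have e5 := edge (1, 1) (2, 1) (by decide)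
  have e6 := edge (1, 0) (2, 0) (by decide)
  have e7 := edge (2, 1) (2, 0) (by decide)
  have e8 := edge (0, 1) (3, 1) (by decide)
  have e9 := edge (2, 1) (3, 1) (by decide)
  have p1 := path (0, 1) (0, 0) (1, 0) (1, 1) (2, 1)
    (by decide) (by decide) (by decide) (by decide) (by decide)
  have p2 := path (0, 0) (1, 0) (1, 1) (2, 1) (2, 0)
    (by decide) (by decide) (by decide) (by decide) (by decide)
  have p3 := path (0, 1) (0, 0) (1, 0) (2, 0) (2, 1)
    (by decide) (by decide) (by decide) (by decide) (by decide)
  have p4 := path (0, 1) (1, 1) (1, 0) (2, 0) (2, 1)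
    (by decide) (by decide) (by decide) (by decide) (by decide)
  have p5 := path (0, 0) (0, 1) (1, 1) (1, 0) (2, 0)
    (by decide) (by decide) (by decide) (by decide) (by decide)
  have p6 := path (0, 0) (0, 1) (1, 1) (2, 1) (2, 0)
    (by decide) (by decide) (by decide) (by decide) (by decide)
  have p7 := path (2, 0) (1, 0) (1, 1) (0, 1) (3, 1)
    (by decide) (by decide) (by decide) (by decide) (by decide)
  have p8 := path (0, 0) (1, 0) (1, 1) (2, 1) (3, 1)
    (by decide) (by decide) (by decide) (by decide) (by decide)
  generalize f (0, 0) = x0, f (0, 1) = x1, f (1, 1) = x2, f (1, 0) = x3,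
    f (2, 1) = x4, f (2, 0) = x5, f (3, 1) = x6 at *
  revert x0 x1 e1 x2 e2 x3 e3 e4 x4 e5 p1 x5 e6 e7 p2 p3 p4 p5 p6 x6 e8 e9 p7 p8
  decide

theorem s5_C4_boxProd_C4 :
    pkChrom ((cycleGraph 4).boxProd (cycleGraph 4)) 5 = 4 := by
  refine le_antisymm (Nat.sInf_le ⟨_, isPkColoring_C4_boxProd_C4⟩)
    (le_csInf ⟨4, _, isPkColoring_C4_boxProd_C4⟩ ?_)
  rintro n ⟨f, hf⟩
  by_contra! hn
  have hn : n ≤ 3 := by omega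
  have inj := Fin.castLE_injective hn
  refine not_isPkColoring_C4_boxProd_C4 (Fin.castLE hn ∘ f)
    (isPkColoring_five_of_not_alternating (fun u w h => inj.ne (hf.1 u w h)) ?_)
  intro a b c d e hab hbc hcd hde h ⟨h₁, h₂, h₃⟩
  exact hf.not_alternating hab hbc hcd hde h ⟨inj h₁, inj h₂, inj h₃⟩
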